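/- For all integers k ≥ 1 and ℓ ≥ 1, there exists a connected graph G with feedback edge number exactly k−1 that has at least ℓ^k minimal matching cuts. -/

import Mathlib

namespace MatchingCutPaper

/-- The set of edges of `G` with one endpoint in `A` and the other endpoint outside `A`. -/
def cutEdges {V : Type} (G : SimpleGraph V) (A : Set V) : Set (Sym2 V) :=
  {e | e ∈ G.edgeSet ∧ ∃ u v : V, e = s(u, v) ∧ u ∈ A ∧ v ∉ A}

/-- `M` is a matching of `G`: a set of edges of `G`, no two of which share an endpoint. -/
def IsMatchingSet {V : Type} (G : SimpleGraph V) (M : Set (Sym2 V)) : Prop :=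
  M ⊆ G.edgeSet ∧ ∀ e ∈ M, ∀ f ∈ M, e ≠ f → ∀ v : V, ¬(v ∈ e ∧ v ∈ f)

/-- `M` is a matching cut of `G`: a matching of the form `E(A, B)` for a partition `{A, B}`
of the vertex set into two nonempty parts. -/
def IsMatchingCut {V : Type} (G : SimpleGraph V) (M : Set (Sym2 V)) : Prop :=
  IsMatchingSet G M ∧ ∃ A : Set V, A.Nonempty ∧ Aᶜ.Nonempty ∧ M = cutEdges G A

/-- A matching cut is minimal if no proper subset of it is a matching cut. -/
def IsMinimalMatchingCut {V : Type} (G : SimpleGraph V) (M : Set (Sym2 V)) : Prop :=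
  IsMatchingCut G M ∧ ∀ M' : Set (Sym2 V), M' ⊂ M → ¬ IsMatchingCut G M'

/-- A matching cut is maximal if no proper superset of it is a matching cut. -/
def IsMaximalMatchingCut {V : Type} (G : SimpleGraph V) (M : Set (Sym2 V)) : Prop :=
  IsMatchingCut G M ∧ ∀ M' : Set (Sym2 V), M ⊂ M' → ¬ IsMatchingCut G M'

/-- The feedback edge number of `G`: the minimum size of a set `S` of edges of `G` whose
deletion makes `G` acyclic. -/
noncomputable def feedbackEdgeNumber {V : Type} (G : SimpleGraph V) : ℕ :=
  sInf {n : ℕ | ∃ S : Set (Sym2 V),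
    S ⊆ G.edgeSet ∧ (G.deleteEdges S).IsAcyclic ∧ S.ncard = n}

theorem card_edgeSet_add_one_of_isTree {V : Type} [Finite V] {T : SimpleGraph V}
    (hT : T.IsTree) : T.edgeSet.ncard + 1 = Nat.card V :=
  (SimpleGraph.isTree_iff_connected_and_card.mp hT).2

theorem feedbackEdgeNumber_add_card {V : Type} [Finite V] {G : SimpleGraph V}
    (hG : G.Connected) : feedbackEdgeNumber G + Nat.card V = G.edgeSet.ncard + 1 := by
  obtain ⟨T, hTG, hT⟩ := hG.exists_isTree_le
  have hsub : T.edgeSet ⊆ G.edgeSet := SimpleGraph.edgeSet_mono hTG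
  have hTc := card_edgeSet_add_one_of_isTree hT
  have hmem : (G.edgeSet \ T.edgeSet).ncard ∈ {n : ℕ | ∃ S : Set (Sym2 V),
      S ⊆ G.edgeSet ∧ (G.deleteEdges S).IsAcyclic ∧ S.ncard = n} := by
    refine ⟨_, Set.sdiff_subset, hT.isAcyclic.anti fun a b hab => ?_, rfl⟩
    rw [SimpleGraph.deleteEdges_adj] at hab
    by_contra h
    exact hab.2 ⟨hab.1, h⟩
  have hle : feedbackEdgeNumber G ≤ (G.edgeSet \ T.edgeSet).ncard := Nat.sInf_le hmem
  obtain ⟨S, -, hS, hcard⟩ : feedbackEdgeNumber G ∈ {n : ℕ | ∃ S : Set (Sym2 V),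
      S ⊆ G.edgeSet ∧ (G.deleteEdges S).IsAcyclic ∧ S.ncard = n} := Nat.sInf_mem ⟨_, hmem⟩
  obtain ⟨F, hSF, -, hF⟩ :=
    hG.exists_isTree_le_of_le_of_isAcyclic (SimpleGraph.deleteEdges_le S) hS
  have hFc := card_edgeSet_add_one_of_isTree hF
  have hcover : G.edgeSet ⊆ F.edgeSet ∪ S := by
    intro e he
    by_cases h : e ∈ S
    · exact Or.inr h
    · refine Or.inl (SimpleGraph.edgeSet_mono hSF ?_)
      rw [SimpleGraph.edgeSet_deleteEdges]
      exact ⟨he, h⟩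
  have h₁ := (Set.ncard_le_ncard hcover).trans (Set.ncard_union_le _ _)
  have h₂ := Set.ncard_sdiff_add_ncard_of_subset hsub
  omega

theorem mk_mem_cutEdges {V : Type} {G : SimpleGraph V} {A : Set V} {a b : V} :
    s(a, b) ∈ cutEdges G A ↔ G.Adj a b ∧ ¬(a ∈ A ↔ b ∈ A) := by
  constructor
  · rintro ⟨h, u, v, huv, hu, hv⟩
    refine ⟨h, ?_⟩
    rcases Sym2.eq_iff.mp huv with ⟨rfl, rfl⟩ | ⟨rfl, rfl⟩ <;> tauto
  · rintro ⟨h, hab⟩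
    by_cases ha : a ∈ A
    · exact ⟨h, a, b, rfl, ha, by tauto⟩
    · exact ⟨h, b, a, Sym2.eq_swap, by tauto, ha⟩

/-- The end vertex of a path of length `ℓ` on the side selected by the Boolean. -/
def pathEnd (ℓ : ℕ) (b : Bool) : Fin (ℓ + 1) := if b then Fin.last ℓ else 0

/-- The edges of the ladder: `(i, j)` indexes the `j`-th edge of the `i`-th subdivided rung,
and `(i, b)` indexes the `i`-th edge of the rail on side `b`. -/
def ladderEdge (n ℓ : ℕ) :
    (Fin (n + 1) × Fin ℓ) ⊕ (Fin n × Bool) → Sym2 (Fin (n + 1) × Fin (ℓ + 1))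
  | .inl (i, j) => s((i, j.castSucc), (i, j.succ))
  | .inr (i, b) => s((i.castSucc, pathEnd ℓ b), (i.succ, pathEnd ℓ b))

/-- The ladder with `n + 1` rungs, each of which is a path of length `ℓ`. -/
def ladder (n ℓ : ℕ) : SimpleGraph (Fin (n + 1) × Fin (ℓ + 1)) :=
  SimpleGraph.fromEdgeSet (Set.range (ladderEdge n ℓ))

theorem ladderEdge_injective {n ℓ : ℕ} (hl : 1 ≤ ℓ) :
    Function.Injective (ladderEdge n ℓ) := by
  rintro (⟨i, j⟩ | ⟨i, b⟩) (⟨i', j'⟩ | ⟨i', b'⟩) h <;>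
    simp only [ladderEdge, Sym2.eq_iff, Prod.mk.injEq, Fin.ext_iff, Fin.val_castSucc,
      Fin.val_succ] at h
  · simp only [Sum.inl.injEq, Prod.mk.injEq, Fin.ext_iff]
    omega
  · omega
  · omega
  · have hi : i = i' := Fin.ext (by omega)
    have hb : b = b' := by
      cases b <;> cases b' <;> simp [pathEnd] at h ⊢ <;> omega
    rw [hi, hb]

theorem edgeSet_ladder (n ℓ : ℕ) : (ladder n ℓ).edgeSet = Set.range (ladderEdge n ℓ) := by
  rw [ladder, SimpleGraph.edgeSet_fromEdgeSet, sdiff_eq_left, Set.disjoint_left]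
  rintro _ ⟨⟨i, j⟩ | ⟨i, b⟩, rfl⟩ h <;>
    simp [ladderEdge, Fin.ext_iff] at h

theorem ladder_adj_rung {n ℓ : ℕ} (i : Fin (n + 1)) (j : Fin ℓ) :
    (ladder n ℓ).Adj (i, j.castSucc) (i, j.succ) := by
  rw [← SimpleGraph.mem_edgeSet, edgeSet_ladder]
  exact ⟨.inl (i, j), rfl⟩

theorem ladder_adj_rail {n ℓ : ℕ} (i : Fin n) (b : Bool) :
    (ladder n ℓ).Adj (i.castSucc, pathEnd ℓ b) (i.succ, pathEnd ℓ b) := by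
  rw [← SimpleGraph.mem_edgeSet, edgeSet_ladder]
  exact ⟨.inr (i, b), rfl⟩

/-- The set consisting of the `f i`-th edge of the `i`-th rung, for every `i`. -/
def rungCut {n ℓ : ℕ} (f : Fin (n + 1) → Fin ℓ) : Set (Sym2 (Fin (n + 1) × Fin (ℓ + 1))) :=
  Set.range fun i => ladderEdge n ℓ (.inl (i, f i))

theorem rungCut_injective {n ℓ : ℕ} (hl : 1 ≤ ℓ) :
    Function.Injective (rungCut : (Fin (n + 1) → Fin ℓ) → _) := by
  intro f g h
  funext i
  obtain ⟨i', hi'⟩ : ladderEdge n ℓ (.inl (i, f i)) ∈ rungCut g := h ▸ ⟨i, rfl⟩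
  have := ladderEdge_injective hl hi'
  simp only [Sum.inl.injEq, Prod.mk.injEq] at this
  obtain ⟨rfl, h'⟩ := this
  exact h'.symm

theorem isMatchingSet_rungCut {n ℓ : ℕ} (f : Fin (n + 1) → Fin ℓ) :
    IsMatchingSet (ladder n ℓ) (rungCut f) := by
  refine ⟨?_, ?_⟩
  · rintro _ ⟨i, rfl⟩
    exact ladder_adj_rung i (f i)
  · rintro _ ⟨i, rfl⟩ _ ⟨j, rfl⟩ hne v ⟨hi, hj⟩
    simp only [ladderEdge, Sym2.mem_iff] at hi hj
    have h₁ : v.1 = i := by rcases hi with rfl | rfl <;> rfl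
    have h₂ : v.1 = j := by rcases hj with rfl | rfl <;> rfl
    exact hne (by rw [← h₁, ← h₂])

theorem cutEdges_ladder_eq_rungCut {n ℓ : ℕ} (f : Fin (n + 1) → Fin ℓ) :
    cutEdges (ladder n ℓ) {v | v.2.val ≤ (f v.1).val} = rungCut f := by
  ext e
  constructor
  · intro he
    obtain ⟨x, rfl⟩ : e ∈ Set.range (ladderEdge n ℓ) := edgeSet_ladder n ℓ ▸ he.1
    rcases x with ⟨i, j⟩ | ⟨i, b⟩
    · have h := (mk_mem_cutEdges.mp he).2
      simp only [Set.mem_ofPred_eq, Fin.val_castSucc, Fin.val_succ] at h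
      have hj : f i = j := Fin.ext (by omega)
      exact ⟨i, by simp only [hj]⟩
    · have h := (mk_mem_cutEdges.mp he).2
      have h₁ := (f i.castSucc).isLt
      have h₂ := (f i.succ).isLt
      cases b
      · simp [pathEnd] at h
      · simp [pathEnd] at h
        omega
  · rintro ⟨i, rfl⟩
    refine mk_mem_cutEdges.mpr ⟨ladder_adj_rung i (f i), ?_⟩
    simp

/-- A vertex set whose cut misses an edge of `rungCut f` and lies in `rungCut f` is trivial. -/
theorem mem_iff_of_cutEdges_ssubset_rungCut {n ℓ : ℕ} {f : Fin (n + 1) → Fin ℓ}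
    {A : Set (Fin (n + 1) × Fin (ℓ + 1))}
    (hA : cutEdges (ladder n ℓ) A ⊂ rungCut f) (v : Fin (n + 1) × Fin (ℓ + 1)) :
    v ∈ A ↔ (0, 0) ∈ A := by
  obtain ⟨hsub, e, he, hne⟩ := Set.ssubset_iff_exists.mp hA
  have hl : 1 ≤ ℓ := (f 0).pos
  have key : ∀ x, ladderEdge n ℓ x ∉ rungCut f →
      ladderEdge n ℓ x ∉ cutEdges (ladder n ℓ) A := fun x hx h => hx (hsub h)
  have rail : ∀ (i : Fin (n + 1)) (b : Bool),
      (i, pathEnd ℓ b) ∈ A ↔ (0, pathEnd ℓ b) ∈ A := by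
    intro i b
    induction i using Fin.induction with
    | zero => rfl
    | succ i ih =>
      have h := key (.inr (i, b)) fun ⟨j, hj⟩ => by
        simpa using ladderEdge_injective hl hj
      have h' : ¬(_ ∧ _) := fun h' => h (mk_mem_cutEdges.mpr h')
      have := ladder_adj_rail (ℓ := ℓ) i b
      tauto
  have step : ∀ (i : Fin (n + 1)) (j : Fin ℓ),
      ladderEdge n ℓ (.inl (i, j)) ∉ cutEdges (ladder n ℓ) A →
      ((i, j.castSucc) ∈ A ↔ (i, j.succ) ∈ A) := by
    intro i j h
    have h' : ¬(_ ∧ _) := fun h' => h (mk_mem_cutEdges.mpr h')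
    have := ladder_adj_rung i j
    tauto
  have rung : ∀ (i : Fin (n + 1)) (j : Fin ℓ), j ≠ f i →
      ((i, j.castSucc) ∈ A ↔ (i, j.succ) ∈ A) := by
    refine fun i j hj => step i j (key _ fun ⟨i', h⟩ => hj ?_)
    have := ladderEdge_injective hl h
    simp only [Sum.inl.injEq, Prod.mk.injEq] at this
    obtain ⟨rfl, h'⟩ := this
    exact h'.symm
  have left : ∀ (i : Fin (n + 1)) (j : Fin (ℓ + 1)), j.val ≤ (f i).val →
      ((i, j) ∈ A ↔ (0, 0) ∈ A) := by
    intro i j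
    induction j using Fin.induction with
    | zero => exact fun _ => rail i false
    | succ j ih =>
      intro hj
      rw [Fin.val_succ] at hj
      rw [← rung i j (fun h => by subst h; omega)]
      exact ih (by rw [Fin.val_castSucc]; omega)
  have right : ∀ (i : Fin (n + 1)) (j : Fin (ℓ + 1)), (f i).val < j.val →
      ((i, j) ∈ A ↔ (0, Fin.last ℓ) ∈ A) := by
    intro i j
    induction j using Fin.reverseInduction with
    | last => exact fun _ => rail i true
    | cast j ih =>
      intro hj
      rw [Fin.val_castSucc] at hj
      rw [rung i j (fun h => by subst h; omega)]
      exact ih (by rw [Fin.val_succ]; omega)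
  obtain ⟨i, rfl⟩ := he
  have hlast : (0, Fin.last ℓ) ∈ A ↔ (0, 0) ∈ A := by
    rw [← right i (f i).succ (by simp), ← left i (f i).castSucc (by simp)]
    exact (step i (f i) hne).symm
  obtain ⟨i', j'⟩ := v
  rcases le_or_gt j'.val (f i').val with h | h
  · exact left i' j' h
  · exact (right i' j' h).trans hlast

theorem isMinimalMatchingCut_rungCut {n ℓ : ℕ} (f : Fin (n + 1) → Fin ℓ) :
    IsMinimalMatchingCut (ladder n ℓ) (rungCut f) := by
  refine ⟨⟨isMatchingSet_rungCut f, _, ⟨(0, 0), ?_⟩, ⟨(0, Fin.last ℓ), ?_⟩,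
    (cutEdges_ladder_eq_rungCut f).symm⟩, ?_⟩
  · simp
  · simp
  · rintro _ hM ⟨-, A, ⟨a, ha⟩, ⟨b, hb⟩, rfl⟩
    have h := mem_iff_of_cutEdges_ssubset_rungCut hM
    exact hb ((h b).mpr ((h a).mp ha))

theorem ladder_connected {n ℓ : ℕ} (hl : 1 ≤ ℓ) : (ladder n ℓ).Connected := by
  rw [SimpleGraph.connected_iff_exists_forall_reachable]
  refine ⟨(0, 0), fun v => ?_⟩
  let A := {v | (ladder n ℓ).Reachable (0, 0) v}
  have hcut : cutEdges (ladder n ℓ) A = ∅ := by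
    rw [Set.eq_empty_iff_forall_notMem]
    rintro _ ⟨he, u, v, rfl, hu, hv⟩
    exact hv (SimpleGraph.Reachable.trans hu (SimpleGraph.Adj.reachable he))
  have hA : cutEdges (ladder n ℓ) A ⊂ rungCut fun _ => ⟨0, hl⟩ := by
    rw [hcut, Set.empty_ssubset]
    exact Set.range_nonempty _
  exact (mem_iff_of_cutEdges_ssubset_rungCut hA v).mpr (SimpleGraph.Reachable.refl _)

theorem feedbackEdgeNumber_ladder {n ℓ : ℕ} (hl : 1 ≤ ℓ) :
    feedbackEdgeNumber (ladder n ℓ) = n := by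
  have h := feedbackEdgeNumber_add_card (ladder_connected (n := n) hl)
  rw [edgeSet_ladder, Set.ncard_range_of_injective (ladderEdge_injective hl)] at h
  simp only [Nat.card_eq_fintype_card, Fintype.card_prod, Fintype.card_sum, Fintype.card_fin,
    Fintype.card_bool] at h
  linarith

/-- For all integers `k ≥ 1` and `ℓ ≥ 1`, there exists a (finite) connected graph with
feedback edge number exactly `k - 1` that has at least `ℓ ^ k` minimal matching cuts. -/
theorem exists_graph_fen_minimalMatchingCuts (k ℓ : ℕ) (hk : 1 ≤ k) (hl : 1 ≤ ℓ) :
    ∃ (V : Type) (G : SimpleGraph V), Finite V ∧ G.Connected ∧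
      feedbackEdgeNumber G = k - 1 ∧
      ℓ ^ k ≤ Nat.card {M : Set (Sym2 V) // IsMinimalMatchingCut G M} := by
  obtain ⟨n, rfl⟩ := Nat.exists_eq_add_of_le' hk
  refine ⟨_, ladder n ℓ, inferInstance, ladder_connected hl, feedbackEdgeNumber_ladder hl, ?_⟩
  have h := Nat.card_le_card_of_injective
    (fun f : Fin (n + 1) → Fin ℓ =>
      (⟨rungCut f, isMinimalMatchingCut_rungCut f⟩ :
        {M : Set (Sym2 _) // IsMinimalMatchingCut (ladder n ℓ) M}))
    fun f g hfg => rungCut_injective hl (congrArg Subtype.val hfg)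
  simpa using h

end MatchingCutPaper
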